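/- Let n ≥ 2 be an integer and let β_n denote the unique root in the open interval (2n−2, 2n−1) of the quartic polynomial Q_n(T) = T⁴ + (4−4n)T³ + (5n²−12n+8)T² + (−2n³+11n²−18n+7)T + (−2n³+6n²−4n). Then for every real number ξ one has ŵ_n(ξ) ≤ β_n. -/

import Mathlib

open Polynomial Filter

noncomputable section

/-- Height of an integer polynomial: maximum absolute value of its coefficients. -/
def polyHeight (P : Polynomial ℤ) : ℕ :=
  P.support.sup fun i => (P.coeff i).natAbs

/-- The set of exponents `w` admissible for the uniform exponent `ŵ_n(ξ)`. -/
def uniformExpSet (n : ℕ) (ξ : ℝ) : Set ℝ :=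
  {w | ∀ᶠ X : ℝ in atTop, ∃ P : Polynomial ℤ, P.natDegree ≤ n ∧
    (polyHeight P : ℝ) ≤ X ∧ 0 < |Polynomial.aeval ξ P| ∧
    |Polynomial.aeval ξ P| < X ^ (-w)}

/-- The uniform exponent `ŵ_n(ξ)`, as an extended real. -/
def wHat (n : ℕ) (ξ : ℝ) : EReal :=
  sSup ((fun w : ℝ => (w : EReal)) '' uniformExpSet n ξ)

/-- The set of exponents `w` admissible for the ordinary exponent `w_n(ξ)`. -/
def ordExpSet (n : ℕ) (ξ : ℝ) : Set ℝ :=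
  {w | {P : Polynomial ℤ | P.natDegree ≤ n ∧ 0 < |Polynomial.aeval ξ P| ∧
      |Polynomial.aeval ξ P| < (polyHeight P : ℝ) ^ (-w)}.Infinite}

/-- The ordinary exponent `w_n(ξ)`, as an extended real. -/
def wOrd (n : ℕ) (ξ : ℝ) : EReal :=
  sSup ((fun w : ℝ => (w : EReal)) '' ordExpSet n ξ)

/-- `P` (1-indexed: the relevant values are `P 1, P 2, …`) is the sequence of best
approximation polynomials associated to `(n, ξ)`. -/
structure IsBestApproxSeq (n : ℕ) (ξ : ℝ) (P : ℕ → Polynomial ℤ) : Prop where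
  ne_zero : ∀ k, 1 ≤ k → P k ≠ 0
  deg_le : ∀ k, 1 ≤ k → (P k).natDegree ≤ n
  height_lt : ∀ k, 1 ≤ k → polyHeight (P k) < polyHeight (P (k+1))
  eval_lt : ∀ k, 1 ≤ k → |Polynomial.aeval ξ (P (k+1))| < |Polynomial.aeval ξ (P k)|
  isMin : ∀ k, 1 ≤ k → ∀ Q : Polynomial ℤ, Q ≠ 0 → Q.natDegree ≤ n →
    polyHeight Q ≤ polyHeight (P k) →
    |Polynomial.aeval ξ (P k)| ≤ |Polynomial.aeval ξ Q|
  complete : ∀ Q : Polynomial ℤ, Q ≠ 0 → Q.natDegree ≤ n →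
    (∀ R : Polynomial ℤ, R ≠ 0 → R.natDegree ≤ n → polyHeight R ≤ polyHeight Q →
      |Polynomial.aeval ξ Q| ≤ |Polynomial.aeval ξ R|) →
    ∃ k, 1 ≤ k ∧ (Q = P k ∨ Q = -P k)

/-- The image of an integer polynomial in `ℚ[X]`. -/
def ratPoly (P : Polynomial ℤ) : Polynomial ℚ := P.map (Int.castRingHom ℚ)

/-- `k` is good for the sequence `P`: `P_{k-1}, P_k, P_{k+1}` are `ℚ`-linearly independent. -/
def Good (P : ℕ → Polynomial ℤ) (k : ℕ) : Prop :=
  LinearIndependent ℚ ![ratPoly (P (k-1)), ratPoly (P k), ratPoly (P (k+1))]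

/-- `τ_k = log H_k / log H_{k-1}`. -/
def tauk (P : ℕ → Polynomial ℤ) (k : ℕ) : ℝ :=
  Real.log (polyHeight (P k)) / Real.log (polyHeight (P (k-1)))

/-- `μ_k = -log |P_{k-1}(ξ)| / log H_k`. -/
def muk (ξ : ℝ) (P : ℕ → Polynomial ℤ) (k : ℕ) : ℝ :=
  - Real.log |Polynomial.aeval ξ (P (k-1))| / Real.log (polyHeight (P k))

/-- `v_k = -log |P_k(ξ)| / log H_k`. -/
def vk (ξ : ℝ) (P : ℕ → Polynomial ℤ) (k : ℕ) : ℝ :=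
  - Real.log |Polynomial.aeval ξ (P k)| / Real.log (polyHeight (P k))

/-- The set of integers `m ≥ k+1` such that `P_{k-1}, …, P_{m-1}` all lie in the
two-dimensional space spanned by `P_{k-1}` and `P_k`; its greatest element is `ℓ(k)`. -/
def ellSet (P : ℕ → Polynomial ℤ) (k : ℕ) : Set ℕ :=
  {m | k + 1 ≤ m ∧ ∀ j, k - 1 ≤ j → j ≤ m - 1 →
    ratPoly (P j) ∈ Submodule.span ℚ {ratPoly (P (k-1)), ratPoly (P k)}}

/-- The set `V_k = {P, T·P, …, T^{n-2}·P}` (as rational polynomials). -/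
def Vset (n : ℕ) (A : Polynomial ℤ) : Set (Polynomial ℚ) :=
  {q | ∃ i ≤ n - 2, q = Polynomial.X ^ i * ratPoly A}

/-- The trajectory `L_P(q) = max(log H(P) - q/(2n-2), log |P(ξ)| + q)`. -/
def LPtraj (n : ℕ) (ξ : ℝ) (Q : Polynomial ℤ) (q : ℝ) : ℝ :=
  max (Real.log (polyHeight Q) - q / (2*(n:ℝ)-2)) (Real.log |Polynomial.aeval ξ Q| + q)

/-- The `j`-th successive minimum function `L_j(q)`: the infimum over sets of `j`
linearly independent integer polynomials of degree at most `2n-2` of the maximum of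
`L_P(q)` over the set. -/
def Lj (n : ℕ) (ξ : ℝ) (j : ℕ) (q : ℝ) : ℝ :=
  sInf {y : ℝ | ∃ S : Finset (Polynomial ℤ), S.card = j ∧
    (∀ Q ∈ S, Q.natDegree ≤ 2*n-2) ∧
    LinearIndependent ℚ (fun Q : {x // x ∈ S} => ratPoly (Q : Polynomial ℤ)) ∧
    y = sSup ((fun Q => LPtraj n ξ Q q) '' (S : Set (Polynomial ℤ)))}

section Height

theorem natAbs_coeff_le_polyHeight (P : ℤ[X]) (i : ℕ) : (P.coeff i).natAbs ≤ polyHeight P := by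
  by_cases h : i ∈ P.support
  · exact Finset.le_sup (f := fun i => (P.coeff i).natAbs) h
  · simp [notMem_support_iff.mp h]

theorem abs_coeff_le_polyHeight (P : ℤ[X]) (i : ℕ) : |(P.coeff i : ℝ)| ≤ polyHeight P := by
  rw [← Int.cast_abs, Int.abs_eq_natAbs]
  exact_mod_cast natAbs_coeff_le_polyHeight P i

theorem exists_abs_coeff_eq_polyHeight (P : ℤ[X]) :
    ∃ i, |(P.coeff i : ℝ)| = polyHeight P := by
  by_cases h : P = 0
  · exact ⟨0, by simp [h, polyHeight]⟩
  · obtain ⟨i, -, hi⟩ := Finset.exists_mem_eq_sup P.support (by simpa using h)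
      fun i => (P.coeff i).natAbs
    refine ⟨i, ?_⟩
    rw [← Int.cast_abs, Int.abs_eq_natAbs, polyHeight, hi]
    rfl

theorem polyHeight_le_of_forall {P : ℤ[X]} {b : ℝ} (h : ∀ i, |(P.coeff i : ℝ)| ≤ b) :
    (polyHeight P : ℝ) ≤ b := by
  obtain ⟨i, hi⟩ := exists_abs_coeff_eq_polyHeight P
  exact hi ▸ h i

theorem one_le_polyHeight {P : ℤ[X]} (h : P ≠ 0) : (1 : ℝ) ≤ polyHeight P := by
  have : 1 ≤ (P.coeff P.natDegree).natAbs :=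
    Int.natAbs_pos.mpr (by simpa using h)
  exact_mod_cast this.trans (natAbs_coeff_le_polyHeight P _)

theorem polyHeight_X_pow_mul_le (P : ℤ[X]) (k : ℕ) :
    (polyHeight (X ^ k * P) : ℝ) ≤ polyHeight P := by
  refine polyHeight_le_of_forall fun i => ?_
  rw [coeff_X_pow_mul']
  split_ifs
  · exact abs_coeff_le_polyHeight P _
  · simp

theorem polyHeight_C_mul (c : ℤ) (P : ℤ[X]) :
    (polyHeight (C c * P) : ℝ) = |(c : ℝ)| * polyHeight P := by
  apply le_antisymm
  · refine polyHeight_le_of_forall fun i => ?_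
    rw [coeff_C_mul, Int.cast_mul, abs_mul]
    gcongr
    exact abs_coeff_le_polyHeight P i
  · obtain ⟨i, hi⟩ := exists_abs_coeff_eq_polyHeight P
    rw [← hi, ← abs_mul, ← Int.cast_mul, ← coeff_C_mul]
    exact abs_coeff_le_polyHeight _ i

/-- The Mahler measure of an integer polynomial. -/
def intMahler (P : ℤ[X]) : ℝ := (P.map (Int.castRingHom ℂ)).mahlerMeasure

theorem intMahler_mul (P Q : ℤ[X]) : intMahler (P * Q) = intMahler P * intMahler Q := by
  simp [intMahler, mahlerMeasure_mul]

theorem one_le_intMahler {P : ℤ[X]} (h : P ≠ 0) : 1 ≤ intMahler P :=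
  one_le_mahlerMeasure_of_ne_zero h

theorem polyHeight_le_two_pow_mul_intMahler {n : ℕ} {P : ℤ[X]} (h : P.natDegree ≤ n) :
    (polyHeight P : ℝ) ≤ 2 ^ n * intMahler P := by
  refine polyHeight_le_of_forall fun i => ?_
  have h1 := norm_coeff_le_choose_mul_mahlerMeasure i (P.map (Int.castRingHom ℂ))
  have h2 : (((P.map (Int.castRingHom ℂ)).natDegree.choose i : ℕ) : ℝ) ≤ 2 ^ n := by
    have : (P.map (Int.castRingHom ℂ)).natDegree.choose i ≤ 2 ^ n :=
      (Nat.choose_le_two_pow _ _).trans (Nat.pow_le_pow_right (by norm_num)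
        (natDegree_map_le.trans h))
    exact_mod_cast this
  simp only [coeff_map, eq_intCast, Complex.norm_intCast] at h1
  exact h1.trans (mul_le_mul_of_nonneg_right h2 (mahlerMeasure_nonneg _))

theorem intMahler_le_mul_polyHeight {n : ℕ} {P : ℤ[X]} (h : P.natDegree ≤ n) :
    intMahler P ≤ (n + 1) * polyHeight P := by
  refine (mahlerMeasure_le_sum_norm_coeff _).trans ?_
  rw [sum_over_range' _ (by simp) (n + 1) (Nat.lt_succ_of_le (natDegree_map_le.trans h))]
  calc _ ≤ ∑ _i ∈ Finset.range (n + 1), (polyHeight P : ℝ) := by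
        gcongr with i
        simpa using abs_coeff_le_polyHeight P i
    _ = _ := by simp

theorem finite_polyHeight_le (n : ℕ) (b : ℝ) :
    {P : ℤ[X] | P.natDegree ≤ n ∧ (polyHeight P : ℝ) ≤ b}.Finite := by
  refine (finite_mahlerMeasure_le n ((n + 1) * b).toNNReal).subset ?_
  rintro P ⟨h1, h2⟩
  refine ⟨h1, (intMahler_le_mul_polyHeight h1).trans ?_⟩
  refine le_trans ?_ (Real.le_coe_toNNReal _)
  gcongr

end Height

section Determinant

/-- A family of `N` linearly independent integer polynomials of degree less than `N` cannot all be
small at `ξ` relative to their heights. -/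
theorem one_le_factorial_mul_prod_of_linearIndependent {ι : Type*} [Fintype ι] [Nonempty ι] (ξ : ℝ)
    (R : ι → ℤ[X]) (hR : LinearIndependent ℤ R) (hdeg : ∀ i, (R i).natDegree < Fintype.card ι)
    (h : ι → ℝ) (B : ℝ) (hh : ∀ i, (polyHeight (R i) : ℝ) ≤ h i)
    (hB : ∀ i, |aeval ξ (R i)| ≤ B * h i) :
    1 ≤ (Fintype.card ι).factorial * (B * ∏ i, h i) := by
  classical
  set N := Fintype.card ι with hN
  have hNpos : 0 < N := Fintype.card_pos
  let e : ι ≃ Fin N := Fintype.equivFin ι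
  let z : ι := e.symm ⟨0, hNpos⟩
  let M : Matrix ι ι ℤ := Matrix.of fun i j => (R i).coeff (e j)
  have hM : M.det ≠ 0 := by
    intro h0
    obtain ⟨v, hv, hv0⟩ := Matrix.exists_vecMul_eq_zero_iff.mpr h0
    apply hv
    have := Fintype.linearIndependent_iff.mp hR v ?_
    · exact funext this
    · ext k
      by_cases hk : k < N
      · have := congrFun hv0 (e.symm ⟨k, hk⟩)
        simpa [Matrix.vecMul, dotProduct, M, finsetSum_coeff] using this
      · simp only [finsetSum_coeff, coeff_smul, coeff_zero]
        refine Finset.sum_eq_zero fun i _ => ?_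
        rw [coeff_eq_zero_of_natDegree_lt (by have := hdeg i; omega), smul_zero]
  let M' : Matrix ι ι ℝ := M.map (Int.cast)
  have hM' : 1 ≤ |M'.det| := by
    have : M'.det = (M.det : ℝ) := by
      simpa using ((Int.castRingHom ℝ).map_det M).symm
    rw [this, ← Int.cast_abs]
    exact_mod_cast Int.one_le_abs hM
  have hcol : (M'.updateCol z fun i => aeval ξ (R i)).det = M'.det := by
    have := Matrix.det_updateCol_sum M' z (fun j => ξ ^ (e j : ℕ))
    simp only [z, Equiv.apply_symm_apply, pow_zero, one_smul] at this
    rw [← this]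
    congr 2
    ext i
    rw [aeval_eq_sum_range' (hdeg i), ← Fin.sum_univ_eq_sum_range (fun k => (R i).coeff k • ξ ^ k),
      ← e.sum_comp]
    refine Finset.sum_congr rfl fun j _ => ?_
    simp [M', M, mul_comm]
  rw [← hcol] at hM'
  refine hM'.trans ?_
  rw [Matrix.det_apply']
  have key : ∀ σ : Equiv.Perm ι,
      ∏ j, |(M'.updateCol z fun i => aeval ξ (R i)) (σ j) j| ≤ B * ∏ i, h i := by
    intro σ
    calc _ ≤ ∏ j, ((if j = z then B else 1) * h (σ j)) := by
          refine Finset.prod_le_prod (fun _ _ => abs_nonneg _) fun j _ => ?_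
          by_cases hj : j = z
          · subst hj; simpa using hB _
          · simpa [hj, Matrix.updateCol_apply, M', M] using
              (abs_coeff_le_polyHeight _ _).trans (hh (σ j))
      _ = _ := by
          rw [Finset.prod_mul_distrib, Equiv.prod_comp σ h]
          simp
  calc _ ≤ ∑ σ : Equiv.Perm ι,
        |(Equiv.Perm.sign σ : ℝ) * ∏ j, (M'.updateCol z fun i => aeval ξ (R i)) (σ j) j| :=
        Finset.abs_sum_le_sum_abs _ _
    _ ≤ ∑ _σ : Equiv.Perm ι, B * ∏ i, h i := by
        refine Finset.sum_le_sum fun σ _ => ?_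
        rw [abs_mul, Finset.abs_prod]
        have : |((Equiv.Perm.sign σ : ℤ) : ℝ)| = 1 := by
          rcases Int.units_eq_one_or (Equiv.Perm.sign σ) with h | h <;> simp [h]
        rw [this, one_mul]
        exact key σ
    _ = _ := by simp [Fintype.card_perm, hN]

end Determinant

section Shifts

/-- The polynomial with coefficient vector `g`. -/
def polyOfFn {k : ℕ} (g : Fin k → ℤ) : ℤ[X] := ∑ i, C (g i) * X ^ (i : ℕ)

theorem polyOfFn_coeff {k : ℕ} (g : Fin k → ℤ) (i : Fin k) : (polyOfFn g).coeff i = g i := by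
  simp [polyOfFn, finsetSum_coeff, Fin.val_inj]

theorem polyOfFn_degree_lt {k : ℕ} (g : Fin k → ℤ) : (polyOfFn g).degree < k := by
  exact degree_sum_fin_lt g

theorem sum_smul_shift {k : ℕ} (g : Fin k → ℤ) (P : ℤ[X]) :
    ∑ i, g i • (X ^ (i : ℕ) * P) = polyOfFn g * P := by
  simp only [polyOfFn, Finset.sum_mul, zsmul_eq_mul, mul_assoc]
  simp

theorem eq_zero_of_prime_of_mul_eq_mul {P Q U V : ℤ[X]} (hQ : Prime Q) (hQP : ¬ Q ∣ P)
    (hU : U.degree < Q.degree) (h : U * P = V * Q) : U = 0 := by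
  have : Q ∣ U * P := h ▸ dvd_mul_left Q V
  rcases hQ.dvd_or_dvd this with h1 | h1
  · by_contra h0
    exact absurd (degree_le_of_dvd h1 h0) (not_le.mpr hU)
  · exact absurd h1 hQP

theorem linearIndependent_shifts {P Q : ℤ[X]} (hQ : Prime Q) (hQP : ¬ Q ∣ P) {a b : ℕ}
    (hb : b ≤ Q.natDegree) :
    LinearIndependent ℤ (Sum.elim (fun i : Fin b => X ^ (i : ℕ) * P)
      (fun i : Fin a => X ^ (i : ℕ) * Q)) := by
  rw [Fintype.linearIndependent_iff]
  intro g hg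
  rw [Fintype.sum_sum_type] at hg
  simp only [Sum.elim_inl, Sum.elim_inr] at hg
  rw [sum_smul_shift (fun i => g (Sum.inl i)), sum_smul_shift (fun i => g (Sum.inr i))] at hg
  have h1 : polyOfFn (fun i => g (Sum.inl i)) = 0 := by
    refine eq_zero_of_prime_of_mul_eq_mul hQ hQP (V := -polyOfFn (fun i => g (Sum.inr i)))
      ((polyOfFn_degree_lt _).trans_le ?_) (by linear_combination hg)
    rw [degree_eq_natDegree hQ.ne_zero]
    exact_mod_cast hb
  have h2 : polyOfFn (fun i => g (Sum.inr i)) = 0 := by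
    rw [h1, zero_mul, zero_add] at hg
    exact (mul_eq_zero.mp hg).resolve_right hQ.ne_zero
  rintro (i | i)
  · rw [← polyOfFn_coeff (fun i => g (Sum.inl i)) i, h1, coeff_zero]
  · rw [← polyOfFn_coeff (fun i => g (Sum.inr i)) i, h2, coeff_zero]

theorem exists_linearIndependent_shifts {m : ℕ} {P Q R : ℤ[X]} (hQ : Prime Q) (hQP : ¬ Q ∣ P)
    (hQd : Q.natDegree = m + 2) (hP : P.natDegree ≤ m + 2) (hR : R.natDegree ≤ m + 2)
    (hind : ∀ c a b : ℤ, C c * R = C a * P + C b * Q → c = 0) :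
    ∃ r ≤ m, LinearIndependent ℤ (Sum.elim (Sum.elim (fun i : Fin (m + 1) => X ^ (i : ℕ) * P)
      (fun i : Fin (m + 1) => X ^ (i : ℕ) * Q)) (fun _ : Unit => X ^ r * R)) := by
  by_contra! hcon
  have hdep : ∀ r, r ≤ m → ∃ (c : ℤ) (U V : ℤ[X]), c ≠ 0 ∧ U.natDegree ≤ m ∧
      C c * (X ^ r * R) = U * P + V * Q := by
    intro r hr
    obtain ⟨g, hg, j, hj⟩ := Fintype.not_linearIndependent_iff.mp (hcon r hr)
    rw [Fintype.sum_sum_type, Fintype.sum_sum_type] at hg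
    simp only [Sum.elim_inl, Sum.elim_inr, Finset.univ_unique, Finset.sum_singleton] at hg
    rw [sum_smul_shift (fun i => g (Sum.inl (Sum.inl i))),
      sum_smul_shift (fun i => g (Sum.inl (Sum.inr i)))] at hg
    set U := polyOfFn (fun i => g (Sum.inl (Sum.inl i))) with hU
    set V := polyOfFn (fun i => g (Sum.inl (Sum.inr i))) with hV
    have hgc : g (Sum.inr default) • (X ^ r * R) = C (g (Sum.inr default)) * (X ^ r * R) := by
      rw [smul_eq_C_mul]
    rw [hgc] at hg
    have hUd : U.degree < ((m + 1 : ℕ) : WithBot ℕ) := polyOfFn_degree_lt _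
    refine ⟨g (Sum.inr default), -U, -V, fun h0 => ?_, ?_, by linear_combination hg⟩
    · rw [h0, C_0, zero_mul, add_zero] at hg
      have hU0 : U = 0 := by
        refine eq_zero_of_prime_of_mul_eq_mul hQ hQP (V := -V) (hUd.trans_le ?_)
          (by linear_combination hg)
        rw [degree_eq_natDegree hQ.ne_zero, hQd]
        exact_mod_cast (by omega)
      have hV0 : V = 0 := by
        rw [hU0, zero_mul, zero_add] at hg
        exact (mul_eq_zero.mp hg).resolve_right hQ.ne_zero
      apply hj
      rcases j with (i | i) | i
      · rw [← polyOfFn_coeff (fun i => g (Sum.inl (Sum.inl i))) i, ← hU, hU0, coeff_zero]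
      · rw [← polyOfFn_coeff (fun i => g (Sum.inl (Sum.inr i))) i, ← hV, hV0, coeff_zero]
      · exact h0
    · rw [natDegree_neg]
      exact natDegree_le_iff_coeff_eq_zero.mpr fun N hN => (degree_lt_iff_coeff_zero _ _).mp hUd N hN
  choose! c U V hc hU hUV using hdep
  have hstep : ∀ r, r + 1 ≤ m → C (c (r + 1)) * (X * U r) = C (c r) * U (r + 1) := by
    intro r hr
    have h1 := hUV r (by omega)
    have h2 := hUV (r + 1) hr
    rw [← sub_eq_zero]
    refine eq_zero_of_prime_of_mul_eq_mul hQ hQP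
      (V := C (c r) * V (r + 1) - C (c (r + 1)) * (X * V r)) ?_ ?_
    · have hd : (C (c (r + 1)) * (X * U r) - C (c r) * U (r + 1)).natDegree ≤ m + 1 := by
        refine (natDegree_sub_le _ _).trans (max_le ?_ ?_)
        · refine (natDegree_C_mul_le _ _).trans (natDegree_mul_le.trans ?_)
          have := hU r (by omega)
          rw [natDegree_X]; omega
        · exact (natDegree_C_mul_le _ _).trans ((hU _ hr).trans (by omega))
      rw [degree_eq_natDegree hQ.ne_zero, hQd]
      refine (degree_le_of_natDegree_le hd).trans_lt ?_
      exact_mod_cast (by omega)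
    · rw [pow_succ] at h2
      linear_combination C (c r) * h2 - C (c (r + 1)) * X * h1
  have hdegU : U 0 ≠ 0 → ∀ r, r ≤ m → U r ≠ 0 ∧ (U r).natDegree = (U 0).natDegree + r := by
    intro h0 r
    induction r with
    | zero => exact fun _ => ⟨h0, by simp⟩
    | succ r ih =>
      intro hr
      obtain ⟨ih1, ih2⟩ := ih (by omega)
      have h := hstep r hr
      have hne : U (r + 1) ≠ 0 := by
        intro h0'
        rw [h0', mul_zero] at h
        exact mul_ne_zero (C_ne_zero.mpr (hc _ hr)) (mul_ne_zero X_ne_zero ih1) h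
      refine ⟨hne, ?_⟩
      have h' := congrArg natDegree h
      rw [natDegree_C_mul (hc _ hr), natDegree_X_mul ih1, natDegree_C_mul (hc r (by omega)), ih2] at h'
      omega
  have hU0 : (U 0).natDegree = 0 := by
    by_cases h0 : U 0 = 0
    · simp [h0]
    · have := (hdegU h0 m le_rfl).2
      have := hU m le_rfl
      omega
  obtain ⟨a, ha⟩ := natDegree_eq_zero.mp hU0
  have hV0 : (V 0).natDegree = 0 := by
    by_cases h0 : V 0 = 0
    · simp [h0]
    have h := hUV 0 (by omega)
    have hd : (V 0 * Q).natDegree ≤ m + 2 := by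
      rw [show V 0 * Q = C (c 0) * (X ^ 0 * R) - C a * P by rw [ha]; linear_combination -h]
      refine (natDegree_sub_le _ _).trans (max_le ?_ ((natDegree_C_mul_le _ _).trans hP))
      rw [pow_zero, one_mul]
      exact (natDegree_C_mul_le _ _).trans hR
    rw [natDegree_mul h0 hQ.ne_zero, hQd] at hd
    omega
  obtain ⟨b, hb⟩ := natDegree_eq_zero.mp hV0
  refine hc 0 (by omega) (hind (c 0) a b ?_)
  have h := hUV 0 (by omega)
  rw [ha, hb, ← h, pow_zero, one_mul]

end Shifts

section Bounds

theorem abs_aeval_X_pow_mul_le {ξ B : ℝ} {P : ℤ[X]} {i n : ℕ} (hi : i ≤ n)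
    (h : |aeval ξ P| ≤ B) : |aeval ξ (X ^ i * P)| ≤ max 1 |ξ| ^ n * B := by
  rw [map_mul, map_pow, aeval_X, abs_mul, abs_pow]
  have h1 : |ξ| ^ i ≤ max 1 |ξ| ^ n :=
    (pow_le_pow_left₀ (abs_nonneg _) (le_max_right _ _) i).trans
      (pow_le_pow_right₀ (le_max_left _ _) hi)
  gcongr

/-- The resultant estimate, for a prime polynomial `Q` of degree at most `n` that does not
divide `P`. -/
theorem one_le_of_prime_of_not_dvd {n : ℕ} {ξ : ℝ} {P Q : ℤ[X]} (hQ : Prime Q) (hQP : ¬ Q ∣ P)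
    (hP : P.natDegree ≤ n) (hQ0 : 1 ≤ Q.natDegree) (hQn : Q.natDegree ≤ n) {p q B : ℝ}
    (hp : (polyHeight P : ℝ) ≤ p) (hq : (polyHeight Q : ℝ) ≤ q)
    (hPB : |aeval ξ P| ≤ B * p) (hQB : |aeval ξ Q| ≤ B * q) :
    1 ≤ ((2 * n).factorial * max 1 |ξ| ^ n) * (B * (p ^ Q.natDegree * q ^ n)) := by
  set d := Q.natDegree with hd
  have : Nonempty (Fin d ⊕ Fin n) := ⟨Sum.inl ⟨0, hQ0⟩⟩
  have h := one_le_factorial_mul_prod_of_linearIndependent ξ _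
    (linearIndependent_shifts hQ hQP (a := n) (b := d) le_rfl) ?_
    (Sum.elim (fun _ => p) (fun _ => q)) (max 1 |ξ| ^ n * B) ?_ ?_
  · simp only [Fintype.prod_sum_type, Sum.elim_inl, Sum.elim_inr, Finset.prod_const,
      Finset.card_univ, Fintype.card_fin, Fintype.card_sum] at h
    have h0 : 0 < max 1 |ξ| ^ n * B * (p ^ d * q ^ n) := by
      by_contra! hle
      have := mul_nonpos_of_nonneg_of_nonpos (Nat.cast_nonneg (α := ℝ) (d + n).factorial) hle
      linarith
    have hf : ((d + n).factorial : ℝ) ≤ (2 * n).factorial := by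
      exact_mod_cast Nat.factorial_le (by omega)
    calc (1 : ℝ) ≤ _ := h
      _ ≤ (2 * n).factorial * (max 1 |ξ| ^ n * B * (p ^ d * q ^ n)) := by gcongr
      _ = _ := by ring
  · rintro (i | i)
    · simp only [Sum.elim_inl, Fintype.card_sum, Fintype.card_fin]
      have := i.2
      refine natDegree_mul_le.trans_lt ?_
      rw [natDegree_X_pow]; omega
    · simp only [Sum.elim_inr, Fintype.card_sum, Fintype.card_fin]
      have := i.2
      refine natDegree_mul_le.trans_lt ?_
      rw [natDegree_X_pow]; omega
  · rintro (i | i)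
    · exact (polyHeight_X_pow_mul_le _ _).trans hp
    · exact (polyHeight_X_pow_mul_le _ _).trans hq
  · rintro (i | i)
    · simpa [mul_assoc] using abs_aeval_X_pow_mul_le (i := i) (by have := i.2; omega) hPB
    · simpa [mul_assoc] using abs_aeval_X_pow_mul_le (i := i) (by have := i.2; omega) hQB

theorem one_le_of_prime_of_independent {m : ℕ} {ξ : ℝ} {P Q R : ℤ[X]} (hQ : Prime Q)
    (hQP : ¬ Q ∣ P) (hQd : Q.natDegree = m + 2) (hP : P.natDegree ≤ m + 2)
    (hR : R.natDegree ≤ m + 2) (hind : ∀ c a b : ℤ, C c * R = C a * P + C b * Q → c = 0)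
    {p q r B : ℝ} (hp : (polyHeight P : ℝ) ≤ p) (hq : (polyHeight Q : ℝ) ≤ q)
    (hr : (polyHeight R : ℝ) ≤ r) (hPB : |aeval ξ P| ≤ B * p) (hQB : |aeval ξ Q| ≤ B * q)
    (hRB : |aeval ξ R| ≤ B * r) :
    1 ≤ ((2 * m + 3).factorial * max 1 |ξ| ^ m) * (B * (p ^ (m + 1) * q ^ (m + 1) * r)) := by
  obtain ⟨k, hk, hli⟩ := exists_linearIndependent_shifts hQ hQP hQd hP hR hind
  have h := one_le_factorial_mul_prod_of_linearIndependent ξ _ hli ?_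
    (Sum.elim (Sum.elim (fun _ => p) (fun _ => q)) (fun _ => r)) (max 1 |ξ| ^ m * B) ?_ ?_
  · simp only [Fintype.prod_sum_type, Sum.elim_inl, Sum.elim_inr, Finset.prod_const,
      Finset.card_univ, Fintype.card_fin, Fintype.card_sum, Fintype.card_unit, pow_one] at h
    rw [show m + 1 + (m + 1) + 1 = 2 * m + 3 by ring] at h
    calc (1 : ℝ) ≤ _ := h
      _ = _ := by ring
  · rintro ((i | i) | i) <;>
      simp only [Sum.elim_inl, Sum.elim_inr, Fintype.card_sum, Fintype.card_fin,
        Fintype.card_unit] <;>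
      refine natDegree_mul_le.trans_lt ?_ <;> rw [natDegree_X_pow] <;> omega
  · rintro ((i | i) | i)
    · exact (polyHeight_X_pow_mul_le _ _).trans hp
    · exact (polyHeight_X_pow_mul_le _ _).trans hq
    · exact (polyHeight_X_pow_mul_le _ _).trans hr
  · rintro ((i | i) | i)
    · simpa [mul_assoc] using abs_aeval_X_pow_mul_le (i := i) (by have := i.2; omega) hPB
    · simpa [mul_assoc] using abs_aeval_X_pow_mul_le (i := i) (by have := i.2; omega) hQB
    · simpa [mul_assoc] using abs_aeval_X_pow_mul_le hk hRB

end Bounds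

section LowerBounds

variable {n : ℕ} {ξ w : ℝ}

theorem exists_prime_dvd_of_aeval_eq_zero {A : ℤ[X]} (hA : A ≠ 0) (h : aeval ξ A = 0) :
    ∃ Q : ℤ[X], Prime Q ∧ Q ∣ A ∧ aeval ξ Q = 0 := by
  induction A using UniqueFactorizationMonoid.induction_on_prime with
  | h₁ => exact absurd rfl hA
  | h₂ u hu => exact absurd h (hu.map (aeval ξ)).ne_zero
  | h₃ a p ha hp ih =>
    rw [map_mul, mul_eq_zero] at h
    rcases h with h | h
    · exact ⟨p, hp, dvd_mul_right p a, h⟩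
    · obtain ⟨Q, hQ, hQa, hQ0⟩ := ih ha h
      exact ⟨Q, hQ, hQa.mul_left p, hQ0⟩

theorem eventually_mul_rpow_neg_lt (C : ℝ) {e ε : ℝ} (he : 0 < e) (hε : 0 < ε) :
    ∀ᶠ x : ℝ in atTop, C * x ^ (-e) < ε := by
  have h := (tendsto_rpow_neg_atTop he).const_mul C
  rw [mul_zero] at h
  exact h.eventually_lt_const hε

theorem aeval_ne_zero_of_mem_uniformExpSet (hw : w ∈ uniformExpSet n ξ) (hwn : (n : ℝ) - 1 < w)
    {A : ℤ[X]} (hA : A ≠ 0) (hAn : A.natDegree ≤ n) : aeval ξ A ≠ 0 := by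
  intro h
  obtain ⟨Q, hQ, hQA, hQ0⟩ := exists_prime_dvd_of_aeval_eq_zero hA h
  have hQn : Q.natDegree ≤ n := (natDegree_le_of_dvd hQA hA).trans hAn
  have hQ1 : 1 ≤ Q.natDegree := by
    by_contra! hlt
    obtain ⟨c, hc⟩ := natDegree_eq_zero.mp (Nat.lt_one_iff.mp hlt)
    rw [← hc] at hQ0
    have : c = 0 := by simpa using hQ0
    exact hQ.ne_zero (by rw [← hc, this, C_0])
  set K : ℝ := (2 * n).factorial * max 1 |ξ| ^ n with hK
  have hev : ∀ᶠ x : ℝ in atTop, K * (polyHeight Q : ℝ) ^ n * x ^ (-(w - n + 1)) < 1 :=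
    eventually_mul_rpow_neg_lt _ (by linarith) one_pos
  obtain ⟨x, hx, ⟨P, hPn, hPx, hP0, hPw⟩, hx1⟩ :=
    (hev.and ((show ∀ᶠ X : ℝ in atTop, _ from hw).and (eventually_ge_atTop 1))).exists
  have hx0 : 0 < x := by linarith
  have hdvd : ¬ Q ∣ P := by
    rintro ⟨T, rfl⟩
    simp [hQ0] at hP0
  have h1 := one_le_of_prime_of_not_dvd (ξ := ξ) hQ hdvd hPn hQ1 hQn hPx le_rfl
    (B := x ^ (-w) / x) (by rw [div_mul_cancel₀ _ hx0.ne']; exact hPw.le)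
    (by rw [hQ0, abs_zero]; positivity)
  have h2 : x ^ (-w) / x * (x ^ Q.natDegree * (polyHeight Q : ℝ) ^ n) ≤
      (polyHeight Q : ℝ) ^ n * x ^ (-(w - n + 1)) := by
    have : x ^ (-(w - n + 1)) = x ^ (-w) / x * x ^ n := by
      rw [show -(w - n + 1) = -w - 1 + n by ring, Real.rpow_add hx0, Real.rpow_sub hx0,
        Real.rpow_one, Real.rpow_natCast]
    rw [this, mul_comm (x ^ Q.natDegree), mul_left_comm]
    gcongr
  have h3 : K * (x ^ (-w) / x * (x ^ Q.natDegree * (polyHeight Q : ℝ) ^ n)) ≤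
      K * ((polyHeight Q : ℝ) ^ n * x ^ (-(w - n + 1))) := by gcongr
  linarith

theorem Set.Finite.exists_pos_forall_le {α : Type*} {s : Set α} (hs : s.Finite) {f : α → ℝ}
    (hf : ∀ a ∈ s, 0 < f a) : ∃ c > 0, ∀ a ∈ s, c ≤ f a := by
  rcases s.eq_empty_or_nonempty with rfl | hne
  · exact ⟨1, one_pos, by simp⟩
  · obtain ⟨a, ha, hmin⟩ := Set.exists_min_image s f hs hne
    exact ⟨f a, hf a ha, hmin⟩

theorem polyHeight_le_of_dvd {P Q : ℤ[X]} (hP : P ≠ 0) (hPn : P.natDegree ≤ n) (h : Q ∣ P) :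
    (polyHeight Q : ℝ) ≤ 2 ^ n * (n + 1) * polyHeight P := by
  have hQn : Q.natDegree ≤ n := (natDegree_le_of_dvd h hP).trans hPn
  obtain ⟨T, rfl⟩ := h
  have hT : T ≠ 0 := right_ne_zero_of_mul hP
  have h0 : 0 ≤ intMahler Q := zero_le_one.trans (one_le_intMahler (left_ne_zero_of_mul hP))
  calc (polyHeight Q : ℝ) ≤ 2 ^ n * intMahler Q := polyHeight_le_two_pow_mul_intMahler hQn
    _ ≤ 2 ^ n * intMahler (Q * T) := by
        rw [intMahler_mul]
        gcongr
        exact le_mul_of_one_le_right h0 (one_le_intMahler hT)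
    _ ≤ 2 ^ n * ((n + 1) * polyHeight (Q * T)) := by
        gcongr
        exact intMahler_le_mul_polyHeight hPn
    _ = _ := by ring

theorem exists_le_abs_aeval_mul_polyHeight_pow_of_prime (hn : 1 ≤ n) (hw : w ∈ uniformExpSet n ξ)
    (hwn : 2 * (n : ℝ) - 2 < w) :
    ∃ c > 0, ∀ Q : ℤ[X], Prime Q → 1 ≤ Q.natDegree → Q.natDegree < n →
      c ≤ |aeval ξ Q| * (polyHeight Q : ℝ) ^ (2 * n - 2) := by
  have hn1 : (1 : ℝ) ≤ n := by exact_mod_cast hn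
  set K : ℝ := (2 * n).factorial * max 1 |ξ| ^ n with hK
  have hK0 : 0 < K := by positivity
  set D : ℝ := 2 * (2 ^ n * (n + 1)) with hD
  have hD0 : 0 < D := by positivity
  have hD1 : 1 ≤ D := by
    have : (1 : ℝ) ≤ 2 ^ n := one_le_pow₀ (by norm_num)
    nlinarith
  have hev : ∀ᶠ x : ℝ in atTop, K * D ^ w * x ^ (-(w - (2 * n - 2))) < 1 :=
    eventually_mul_rpow_neg_lt _ (by linarith) one_pos
  have hev2 : ∀ᶠ x : ℝ in atTop, ∃ P : ℤ[X], P.natDegree ≤ n ∧ (polyHeight P : ℝ) ≤ x / D ∧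
      0 < |aeval ξ P| ∧ |aeval ξ P| < (x / D) ^ (-w) :=
    (tendsto_id.atTop_div_const hD0).eventually hw
  obtain ⟨x₀, hx₀⟩ := eventually_atTop.mp (hev.and hev2)
  obtain ⟨c₀, hc₀, hmin⟩ := ((finite_polyHeight_le n x₀).inter_of_left
    {P : ℤ[X] | P ≠ 0}).exists_pos_forall_le (f := fun P => |aeval ξ P|) (by
      rintro P ⟨⟨hP1, -⟩, hP0⟩
      exact abs_pos.mpr (aeval_ne_zero_of_mem_uniformExpSet hw (by linarith) hP0 hP1))
  refine ⟨min c₀ K⁻¹, by positivity, fun Q hQ hQ1 hQn => ?_⟩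
  have hh1 : (1 : ℝ) ≤ polyHeight Q := one_le_polyHeight hQ.ne_zero
  set h : ℝ := (polyHeight Q : ℝ) with hh
  have hh0 : 0 < h := by linarith
  rcases le_total h x₀ with hle | hge
  · refine (min_le_left _ _).trans ((hmin Q ⟨⟨hQn.le, hle⟩, hQ.ne_zero⟩).trans ?_)
    exact le_mul_of_one_le_right (abs_nonneg _) (one_le_pow₀ hh1)
  refine (min_le_right _ _).trans ?_
  obtain ⟨hsmall, P, hPn, hPh, hP0, hPw⟩ := hx₀ h hge
  have hPne : P ≠ 0 := by rintro rfl; simp at hP0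
  have hdvd : ¬ Q ∣ P := by
    intro hd
    have h1 := polyHeight_le_of_dvd hPne hPn hd
    have h2 : 2 ^ n * ((n : ℝ) + 1) * polyHeight P ≤ 2 ^ n * (n + 1) * (h / D) := by gcongr
    have h3 : 2 ^ n * ((n : ℝ) + 1) * (h / D) = h / 2 := by rw [hD]; field_simp
    linarith
  set b := max |aeval ξ P| |aeval ξ Q| with hb
  have h1 := one_le_of_prime_of_not_dvd (ξ := ξ) (p := h) (q := h) hQ hdvd hPn hQ1 hQn.le
    (hPh.trans (div_le_self hh0.le hD1)) le_rfl
    (B := b / h) (by rw [div_mul_cancel₀ _ hh0.ne']; exact le_max_left _ _)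
    (by rw [div_mul_cancel₀ _ hh0.ne']; exact le_max_right _ _)
  have h2 : b / h * (h ^ Q.natDegree * h ^ n) ≤ b * h ^ (2 * n - 2) := by
    rw [← pow_add, div_mul_eq_mul_div, div_le_iff₀ hh0, mul_assoc, ← pow_succ]
    have hb0 : 0 ≤ b := (abs_nonneg _).trans (le_max_left _ _)
    exact mul_le_mul_of_nonneg_left (pow_le_pow_right₀ hh1 (by omega)) hb0
  have h3 : 1 ≤ K * (b * h ^ (2 * n - 2)) := h1.trans (by gcongr)
  have h4 : K * (|aeval ξ P| * h ^ (2 * n - 2)) < 1 := by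
    refine lt_of_le_of_lt ?_ hsmall
    have : h ^ (-(w - (2 * n - 2))) = h ^ (-w) * h ^ (2 * n - 2) := by
      rw [show -(w - (2 * n - 2)) = -w + ((2 * n - 2 : ℕ) : ℝ) by
        push_cast [Nat.cast_sub (show 2 ≤ 2 * n by omega)]; ring, Real.rpow_add hh0,
        Real.rpow_natCast]
    have h5 : (h / D) ^ (-w) = D ^ w * h ^ (-w) := by
      rw [Real.div_rpow hh0.le hD0.le, Real.rpow_neg hD0.le, div_inv_eq_mul, mul_comm]
    rw [this, show K * D ^ w * (h ^ (-w) * h ^ (2 * n - 2)) =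
      K * (D ^ w * h ^ (-w) * h ^ (2 * n - 2)) by ring, ← h5]
    gcongr
  rcases max_choice |aeval ξ P| |aeval ξ Q| with hm | hm
  · rw [hb, hm] at h3; linarith
  · rw [hb, hm] at h3
    rwa [inv_le_iff_one_le_mul₀' hK0]

theorem exists_le_abs_aeval_mul_intMahler_pow (hn : 1 ≤ n) (hw : w ∈ uniformExpSet n ξ)
    (hwn : 2 * (n : ℝ) - 2 < w) :
    ∃ c > 0, ∀ A : ℤ[X], A ≠ 0 → A.natDegree < n →
      c ≤ |aeval ξ A| * intMahler A ^ (2 * n - 2) := by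
  obtain ⟨c₀, hc₀, hprime⟩ := exists_le_abs_aeval_mul_polyHeight_pow_of_prime hn hw hwn
  set c := min 1 (c₀ / (2 ^ n) ^ (2 * n - 2)) with hc
  have hc0 : 0 < c := by positivity
  have hc1 : c ≤ 1 := min_le_left _ _
  have key : ∀ A : ℤ[X], A ≠ 0 → A.natDegree < n →
      c ^ A.natDegree ≤ |aeval ξ A| * intMahler A ^ (2 * n - 2) := by
    intro A
    have hconst : ∀ a : ℤ, (C a : ℤ[X]) ≠ 0 →
        c ^ (C a : ℤ[X]).natDegree ≤ |aeval ξ (C a)| * intMahler (C a) ^ (2 * n - 2) := by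
      intro a ha
      rw [natDegree_C, pow_zero]
      refine one_le_mul_of_one_le_of_one_le ?_ (one_le_pow₀ (one_le_intMahler ha))
      have : a ≠ 0 := by simpa using ha
      simpa [← Int.cast_abs] using (by exact_mod_cast Int.one_le_abs this : (1 : ℝ) ≤ (|a| : ℤ))
    induction A using UniqueFactorizationMonoid.induction_on_prime with
    | h₁ => exact fun h => absurd rfl h
    | h₂ u hu =>
      intro h0 _
      obtain ⟨a, ha⟩ := natDegree_eq_zero.mp (natDegree_eq_zero_of_isUnit hu)
      rw [← ha] at h0 ⊢
      exact hconst a h0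
    | h₃ a p ha hp ih =>
      intro h0 hd
      rw [natDegree_mul hp.ne_zero ha] at hd ⊢
      rw [pow_add, map_mul, abs_mul, intMahler_mul, mul_pow, mul_mul_mul_comm]
      have h1 := ih ha (by omega)
      refine mul_le_mul ?_ h1 (by positivity)
        (mul_nonneg (abs_nonneg _) (pow_nonneg (mahlerMeasure_nonneg _) _))
      rcases Nat.eq_zero_or_pos p.natDegree with hp0 | hp0
      · obtain ⟨b, hb⟩ := natDegree_eq_zero.mp hp0
        have := hp.ne_zero
        rw [← hb] at this ⊢
        exact hconst b this
      · refine (pow_le_of_le_one hc0.le hc1 hp0.ne').trans ((min_le_right _ _).trans ?_)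
        rw [div_le_iff₀ (by positivity), mul_assoc, ← mul_pow]
        refine (hprime p hp hp0 (by omega)).trans ?_
        gcongr
        rw [mul_comm]
        exact polyHeight_le_two_pow_mul_intMahler (by omega)
  refine ⟨c ^ n, by positivity, fun A hA hAn => ?_⟩
  exact (pow_le_pow_of_le_one hc0.le hc1 hAn.le).trans (key A hA hAn)

theorem exists_le_abs_aeval_mul_polyHeight_pow_of_mul (hn : 1 ≤ n) (hw : w ∈ uniformExpSet n ξ)
    (hwn : 2 * (n : ℝ) - 2 < w) :
    ∃ c > 0, ∀ A B : ℤ[X], A * B ≠ 0 → A.natDegree < n → B.natDegree < n →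
      (A * B).natDegree ≤ n → c ≤ |aeval ξ (A * B)| * (polyHeight (A * B) : ℝ) ^ (2 * n - 2) := by
  obtain ⟨c, hc, h⟩ := exists_le_abs_aeval_mul_intMahler_pow hn hw hwn
  refine ⟨c * c / (n + 1) ^ (2 * n - 2), by positivity, fun A B h0 hA hB hd => ?_⟩
  have h1 := mul_le_mul (h A (left_ne_zero_of_mul h0) hA) (h B (right_ne_zero_of_mul h0) hB)
    hc.le (mul_nonneg (abs_nonneg _) (pow_nonneg (mahlerMeasure_nonneg _) _))
  rw [mul_mul_mul_comm, ← mul_pow, ← intMahler_mul, ← abs_mul, ← map_mul] at h1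
  rw [div_le_iff₀ (by positivity), mul_assoc, ← mul_pow]
  refine h1.trans ?_
  have := intMahler_le_mul_polyHeight hd
  have h0' : 0 ≤ intMahler (A * B) := mahlerMeasure_nonneg _
  rw [mul_comm (polyHeight (A * B) : ℝ)]
  gcongr

end LowerBounds

section MinimalPoints

/-- `P` is a minimal point: no nonzero integer polynomial of degree at most `n` and of no larger
height takes a smaller absolute value at `ξ`. -/
structure IsMinimalPoint (n : ℕ) (ξ : ℝ) (P : ℤ[X]) : Prop where
  ne_zero : P ≠ 0
  natDegree_le : P.natDegree ≤ n
  le : ∀ R : ℤ[X], R ≠ 0 → R.natDegree ≤ n → polyHeight R ≤ polyHeight P →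
    |aeval ξ P| ≤ |aeval ξ R|

variable {n : ℕ} {ξ w : ℝ}

theorem exists_prime_of_isMinimalPoint (hn : 2 ≤ n) (hw : w ∈ uniformExpSet n ξ)
    (hwn : 2 * (n : ℝ) - 2 < w) :
    ∃ c > 0, ∀ P : ℤ[X], IsMinimalPoint n ξ P →
      |aeval ξ P| * (polyHeight P : ℝ) ^ (2 * n - 2) < c → Prime P ∧ P.natDegree = n := by
  obtain ⟨c, hc, h⟩ := exists_le_abs_aeval_mul_polyHeight_pow_of_mul (by omega) hw hwn
  refine ⟨c, hc, fun P hP hlt => ?_⟩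
  have hdeg : P.natDegree = n := by
    by_contra hne
    have := h P 1 (by simpa using hP.ne_zero) (lt_of_le_of_ne hP.natDegree_le hne)
      (by simp; omega) (by simpa using hP.natDegree_le)
    rw [mul_one] at this
    linarith
  have hconst : ∀ (A : ℤ[X]) (b : ℤ), P = A * C b → IsUnit b := by
    rintro A b rfl
    have hA : A ≠ 0 := left_ne_zero_of_mul hP.ne_zero
    have hb : b ≠ 0 := by simpa using right_ne_zero_of_mul hP.ne_zero
    have hb1 : (1 : ℝ) ≤ |(b : ℝ)| := by
      rw [← Int.cast_abs]; exact_mod_cast Int.one_le_abs hb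
    have hA0 : 0 < |aeval ξ A| := abs_pos.mpr (aeval_ne_zero_of_mem_uniformExpSet hw
      (by have : (2 : ℝ) ≤ n := by exact_mod_cast hn
          linarith) hA
      (by rw [← hdeg]; exact natDegree_le_of_dvd (dvd_mul_right _ _) hP.ne_zero))
    have h1 := hP.le A hA
      (by rw [← hdeg]; exact natDegree_le_of_dvd (dvd_mul_right _ _) hP.ne_zero) (by
        have := polyHeight_C_mul b A
        rw [mul_comm] at this
        have h2 : (polyHeight A : ℝ) ≤ polyHeight (A * C b) := by
          rw [this]; exact le_mul_of_one_le_left (Nat.cast_nonneg _) hb1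
        exact_mod_cast h2)
    rw [map_mul, abs_mul] at h1
    have h2 : |(b : ℝ)| ≤ 1 := by
      by_contra! h3
      have : |aeval ξ (C b : ℤ[X])| = |(b : ℝ)| := by simp
      rw [this] at h1
      nlinarith
    rw [Int.isUnit_iff_abs_eq]
    have : |(b : ℝ)| = 1 := le_antisymm h2 hb1
    exact_mod_cast this
  refine ⟨Irreducible.prime ⟨fun hu => ?_, fun A B hAB => ?_⟩, hdeg⟩
  · have := natDegree_eq_zero_of_isUnit hu
    omega
  · have h0 : A * B ≠ 0 := hAB ▸ hP.ne_zero
    have hd : A.natDegree + B.natDegree = n := by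
      rw [← natDegree_mul (left_ne_zero_of_mul h0) (right_ne_zero_of_mul h0), ← hAB, hdeg]
    rcases Nat.eq_zero_or_pos A.natDegree with hA | hA
    · obtain ⟨a, rfl⟩ := natDegree_eq_zero.mp hA
      exact Or.inl (isUnit_C.mpr (hconst B a (by rw [hAB, mul_comm])))
    rcases Nat.eq_zero_or_pos B.natDegree with hB | hB
    · obtain ⟨b, rfl⟩ := natDegree_eq_zero.mp hB
      exact Or.inr (isUnit_C.mpr (hconst A b hAB))
    have := h A B h0 (by omega) (by omega) (by rw [← hAB]; exact hP.natDegree_le)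
    rw [← hAB] at this
    linarith

/-- `(P, Q)` is a pair of consecutive minimal points. -/
structure IsConsecutive (n : ℕ) (ξ : ℝ) (P Q : ℤ[X]) : Prop where
  left : IsMinimalPoint n ξ P
  right : IsMinimalPoint n ξ Q
  height_lt : polyHeight P < polyHeight Q
  aeval_lt : |aeval ξ Q| < |aeval ξ P|
  le_of_height_lt : ∀ R : ℤ[X], R ≠ 0 → R.natDegree ≤ n → polyHeight R < polyHeight Q →
    |aeval ξ P| ≤ |aeval ξ R|

theorem exists_minimal_of_exists (n : ℕ) (ξ : ℝ) (p : ℤ[X] → Prop)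
    (h : ∃ R : ℤ[X], R ≠ 0 ∧ R.natDegree ≤ n ∧ p R) :
    ∃ Q : ℤ[X], Q ≠ 0 ∧ Q.natDegree ≤ n ∧ p Q ∧
      (∀ R : ℤ[X], R ≠ 0 → R.natDegree ≤ n → p R → polyHeight Q ≤ polyHeight R) ∧
      ∀ R : ℤ[X], R ≠ 0 → R.natDegree ≤ n → p R → polyHeight R ≤ polyHeight Q →
        |aeval ξ Q| ≤ |aeval ξ R| := by
  obtain ⟨S, ⟨hS0, hSn, hSp⟩, hSmin⟩ := exists_minimalFor_of_wellFoundedLT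
    (fun R : ℤ[X] => R ≠ 0 ∧ R.natDegree ≤ n ∧ p R) polyHeight h
  have hmin : ∀ R : ℤ[X], R ≠ 0 → R.natDegree ≤ n → p R → polyHeight S ≤ polyHeight R := by
    intro R h0 hn hp
    rcases le_total (polyHeight S) (polyHeight R) with h | h
    · exact h
    · exact hSmin ⟨h0, hn, hp⟩ h
  obtain ⟨Q, ⟨⟨hQn, hQh⟩, hQ0, hQp⟩, hQmin⟩ := Set.exists_min_image
    ({P : ℤ[X] | P.natDegree ≤ n ∧ (polyHeight P : ℝ) ≤ polyHeight S} ∩ {P | P ≠ 0 ∧ p P})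
    (fun P => |aeval ξ P|) ((finite_polyHeight_le n _).inter_of_left _)
    ⟨S, ⟨hSn, le_rfl⟩, hS0, hSp⟩
  have hQS : polyHeight Q ≤ polyHeight S := by exact_mod_cast hQh
  refine ⟨Q, hQ0, hQn, hQp, fun R h0 hn hp => hQS.trans (hmin R h0 hn hp), ?_⟩
  intro R h0 hn hp hR
  exact hQmin R ⟨⟨hn, by exact_mod_cast hR.trans hQS⟩, h0, hp⟩

theorem exists_isMinimalPoint (n : ℕ) (ξ : ℝ) : ∃ P, IsMinimalPoint n ξ P := by
  obtain ⟨Q, h0, hn, -, -, h⟩ := exists_minimal_of_exists n ξ (fun _ => True)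
    ⟨1, one_ne_zero, by simp, trivial⟩
  exact ⟨Q, h0, hn, fun R hR0 hRn hRh => h R hR0 hRn trivial hRh⟩

theorem exists_isConsecutive (hsmall : ∀ ε > 0, ∃ R : ℤ[X], R ≠ 0 ∧ R.natDegree ≤ n ∧
      |aeval ξ R| < ε) (hne : ∀ R : ℤ[X], R ≠ 0 → R.natDegree ≤ n → aeval ξ R ≠ 0)
    {P : ℤ[X]} (hP : IsMinimalPoint n ξ P) : ∃ Q, IsConsecutive n ξ P Q := by
  obtain ⟨Q, h0, hn, hQP, hmin, h⟩ := exists_minimal_of_exists n ξ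
    (fun R => |aeval ξ R| < |aeval ξ P|)
    (hsmall _ (abs_pos.mpr (hne P hP.ne_zero hP.natDegree_le)))
  refine ⟨Q, hP, ⟨h0, hn, fun R hR0 hRn hRh => ?_⟩, ?_, hQP, fun R hR0 hRn hRh => ?_⟩
  · by_contra! hlt
    exact absurd (h R hR0 hRn (hlt.trans hQP) hRh) (not_le.mpr hlt)
  · by_contra! hle
    exact absurd (hP.le Q h0 hn hle) (not_le.mpr hQP)
  · by_contra! hlt
    exact absurd (hmin R hR0 hRn hlt) (not_le.mpr hRh)

end MinimalPoints

section Plane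

variable {n : ℕ} {ξ : ℝ} {P Q : ℤ[X]}

/-- Consecutive minimal points generate all integer polynomials in the plane they span. -/
theorem IsConsecutive.exists_eq_add_of_smul_eq (hPQ : IsConsecutive n ξ P Q) {R : ℤ[X]}
    (hR : R.natDegree ≤ n) {c a b : ℤ} (hc : c ≠ 0) (h : C c * R = C a * P + C b * Q) :
    ∃ a' b' : ℤ, R = C a' * P + C b' * Q := by
  have hc' : (c : ℝ) ≠ 0 := by exact_mod_cast hc
  set a' := round ((a : ℝ) / c) with ha'
  set b' := round ((b : ℝ) / c) with hb'
  set r : ℝ := a / c - a' with hr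
  set s : ℝ := b / c - b' with hs
  have hr2 : |r| ≤ 1 / 2 := abs_sub_round _
  have hs2 : |s| ≤ 1 / 2 := abs_sub_round _
  refine ⟨a', b', ?_⟩
  by_contra hne
  set T := R - (C a' * P + C b' * Q) with hT
  have hT0 : T ≠ 0 := sub_ne_zero.mpr hne
  have hTn : T.natDegree ≤ n := by
    refine (natDegree_sub_le _ _).trans (max_le hR ((natDegree_add_le _ _).trans (max_le ?_ ?_)))
    · exact (natDegree_C_mul_le _ _).trans hPQ.left.natDegree_le
    · exact (natDegree_C_mul_le _ _).trans hPQ.right.natDegree_le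
  have hcomb : ∀ x y : ℝ, |r * x + s * y| ≤ (|x| + |y|) / 2 := by
    intro x y
    refine (abs_add_le _ _).trans ?_
    rw [abs_mul, abs_mul]
    have h1 := mul_le_mul_of_nonneg_right hr2 (abs_nonneg x)
    have h2 := mul_le_mul_of_nonneg_right hs2 (abs_nonneg y)
    linarith
  have hcoeff : ∀ i, (T.coeff i : ℝ) = r * P.coeff i + s * Q.coeff i := by
    intro i
    have h1 := congrArg (fun p : ℤ[X] => ((p.coeff i : ℤ) : ℝ)) h
    simp only [coeff_add, coeff_C_mul, Int.cast_add, Int.cast_mul] at h1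
    simp only [hT, coeff_sub, coeff_add, coeff_C_mul, Int.cast_add, Int.cast_mul, Int.cast_sub,
      hr, hs]
    field_simp
    linear_combination h1
  have heval : aeval ξ T = r * aeval ξ P + s * aeval ξ Q := by
    have h1 := congrArg (aeval ξ) h
    simp only [map_add, map_mul, eq_intCast, map_intCast] at h1
    simp only [hT, map_sub, map_add, map_mul, eq_intCast, map_intCast, hr, hs]
    field_simp
    linear_combination h1
  have hlt : (polyHeight P : ℝ) < polyHeight Q := by exact_mod_cast hPQ.height_lt
  have hTh : (polyHeight T : ℝ) < polyHeight Q := by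
    obtain ⟨i, hi⟩ := exists_abs_coeff_eq_polyHeight T
    rw [← hi, hcoeff]
    have h1 := hcomb (P.coeff i) (Q.coeff i)
    have h2 := abs_coeff_le_polyHeight P i
    have h3 := abs_coeff_le_polyHeight Q i
    linarith
  have h1 := hPQ.le_of_height_lt T hT0 hTn (by exact_mod_cast hTh)
  rw [heval] at h1
  have h2 := hcomb (aeval ξ P) (aeval ξ Q)
  have h3 := hPQ.aeval_lt
  linarith

theorem IsConsecutive.exists_le_minor (hPQ : IsConsecutive n ξ P Q) :
    ∃ i, |aeval ξ P| * polyHeight Q ≤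
      2 * |P.coeff i * aeval ξ Q - Q.coeff i * aeval ξ P| := by
  have hlt : (polyHeight P : ℝ) < polyHeight Q := by exact_mod_cast hPQ.height_lt
  have hQ0 : (0 : ℝ) ≤ polyHeight Q := Nat.cast_nonneg _
  set p := aeval ξ P with hp
  set q := aeval ξ Q with hq
  have hpq : |q| < |p| := hPQ.aeval_lt
  -- Subtracting `ε P` from `Q` makes the value at `ξ` at most half of that of `P`.
  obtain ⟨ε, hε, hD⟩ : ∃ ε : ℤ, ε ^ 2 ≤ 1 ∧ |q - ε * p| ≤ |p| / 2 ∧ |q - ε * p| < |p| ∧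
      (ε ≠ 0 → Q - C ε * P ≠ 0) := by
    by_cases h : |q| ≤ |p| / 2
    · refine ⟨0, by norm_num, by simpa using h, by simpa using hpq, fun h => absurd rfl h⟩
    · push Not at h
      have hzero : ∀ ε : ℤ, |(ε : ℝ)| = 1 → Q - C ε * P ≠ 0 := by
        intro ε hε h0
        have h1 := congrArg (aeval ξ) h0
        simp only [map_sub, map_mul, eq_intCast, map_intCast, map_zero] at h1
        have h2 : |q| = |p| := by
          rw [hq, sub_eq_zero.mp h1, abs_mul, hε, one_mul]
        linarith
      have hsign : ∃ ε : ℤ, (ε = 1 ∨ ε = -1) ∧ |q - ε * p| ≤ |p| / 2 ∧ |q - ε * p| < |p| := by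
        rcases le_total 0 p with h1 | h1 <;> rcases le_total 0 q with h2 | h2
        · refine ⟨1, Or.inl rfl, ?_⟩
          rw [abs_of_nonneg h1, abs_of_nonneg h2] at *
          push_cast
          rw [abs_of_nonpos (by linarith)]; constructor <;> linarith
        · refine ⟨-1, Or.inr rfl, ?_⟩
          rw [abs_of_nonneg h1, abs_of_nonpos h2] at *
          push_cast
          rw [abs_of_nonneg (by linarith)]; constructor <;> linarith
        · refine ⟨-1, Or.inr rfl, ?_⟩
          rw [abs_of_nonpos h1, abs_of_nonneg h2] at *
          push_cast
          rw [abs_of_nonpos (by linarith)]; constructor <;> linarith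
        · refine ⟨1, Or.inl rfl, ?_⟩
          rw [abs_of_nonpos h1, abs_of_nonpos h2] at *
          push_cast
          rw [abs_of_nonneg (by linarith)]; constructor <;> linarith
      obtain ⟨ε, hε, h1, h2⟩ := hsign
      refine ⟨ε, ?_, h1, h2, fun _ => hzero ε ?_⟩ <;> rcases hε with rfl | rfl <;> norm_num
  obtain ⟨hD1, hD2, hD3⟩ := hD
  set D := Q - C ε * P with hDdef
  have hDheight : (polyHeight Q : ℝ) ≤ polyHeight D := by
    by_cases hε0 : ε = 0
    · simp [hDdef, hε0]
    · by_contra! hlt'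
      have h1 := hPQ.le_of_height_lt D (hD3 hε0)
        ((natDegree_sub_le _ _).trans (max_le hPQ.right.natDegree_le
          ((natDegree_C_mul_le _ _).trans hPQ.left.natDegree_le))) (by exact_mod_cast hlt')
      have h2 : aeval ξ D = q - ε * p := by simp [hDdef, hp, hq]
      rw [h2] at h1
      linarith
  obtain ⟨i, hi⟩ := exists_abs_coeff_eq_polyHeight D
  refine ⟨i, ?_⟩
  have hDi : (D.coeff i : ℝ) = Q.coeff i - ε * P.coeff i := by simp [hDdef]
  have hrew : (P.coeff i : ℝ) * q - Q.coeff i * p =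
      P.coeff i * (q - ε * p) - D.coeff i * p := by rw [hDi]; ring
  rw [hrew, abs_sub_comm]
  have h1 := abs_sub_abs_le_abs_sub ((D.coeff i : ℝ) * p) (P.coeff i * (q - ε * p))
  rw [abs_mul, abs_mul, hi] at h1
  have h2 : |(P.coeff i : ℝ)| * |q - ε * p| ≤ polyHeight Q * (|p| / 2) :=
    mul_le_mul ((abs_coeff_le_polyHeight P i).trans hlt.le) hD1 (abs_nonneg _) hQ0
  have h3 : (polyHeight Q : ℝ) * |p| ≤ polyHeight D * |p| :=
    mul_le_mul_of_nonneg_right hDheight (abs_nonneg _)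
  linarith

/-- For pairs of consecutive minimal points in a common plane, `|P(ξ)| H(Q)` is essentially
constant. -/
theorem IsConsecutive.mul_height_le {P' Q' : ℤ[X]} (hPQ : IsConsecutive n ξ P Q)
    (hPQ' : IsConsecutive n ξ P' Q') (hQ' : Prime Q') (hdeg : 1 ≤ Q'.natDegree)
    (hdvd : ¬ Q' ∣ P') {a b c d : ℤ} (hP' : P' = C a * P + C b * Q)
    (hQeq : Q' = C c * P + C d * Q) :
    |aeval ξ P| * polyHeight Q ≤ 4 * (|aeval ξ P'| * polyHeight Q') := by
  have hdet : a * d - b * c ≠ 0 := by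
    intro h0
    have hCd : C (a * d - b * c) = (0 : ℤ[X]) := by rw [h0, C_0]
    simp only [C_sub, C_mul] at hCd
    have hconst : ∀ e f : ℤ, C e * P' = C f * Q' → e = 0 ∧ f = 0 := by
      intro e f hef
      have he : e = 0 := by
        rcases hQ'.dvd_or_dvd (hef ▸ dvd_mul_left Q' (C f) : Q' ∣ C e * P') with h | h
        · by_contra hne
          have := natDegree_le_of_dvd h (C_ne_zero.mpr hne)
          rw [natDegree_C] at this
          omega
        · exact absurd h hdvd
      refine ⟨he, ?_⟩
      rw [he, C_0, zero_mul] at hef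
      simpa using (mul_eq_zero.mp hef.symm).resolve_right hQ'.ne_zero
    obtain ⟨-, hb⟩ := hconst d b (by rw [hP', hQeq]; linear_combination P * hCd)
    obtain ⟨-, ha⟩ := hconst c a (by rw [hP', hQeq]; linear_combination -Q * hCd)
    exact hPQ'.left.ne_zero (by rw [hP', ha, hb]; simp)
  obtain ⟨i, hi⟩ := hPQ.exists_le_minor
  set p := aeval ξ P
  set q := aeval ξ Q
  have hp' : aeval ξ P' = a * p + b * q := by rw [hP']; simp [p, q]
  have hq' : aeval ξ Q' = c * p + d * q := by rw [hQeq]; simp [p, q]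
  have hminor : (P'.coeff i : ℝ) * aeval ξ Q' - Q'.coeff i * aeval ξ P' =
      (a * d - b * c : ℤ) * (P.coeff i * q - Q.coeff i * p) := by
    rw [hp', hq', hP', hQeq]
    simp only [coeff_add, coeff_C_mul]
    push_cast
    ring
  have h1 : |P.coeff i * q - Q.coeff i * p| ≤
      |(P'.coeff i : ℝ) * aeval ξ Q' - Q'.coeff i * aeval ξ P'| := by
    rw [hminor, abs_mul]
    refine le_mul_of_one_le_left (abs_nonneg _) ?_
    rw [← Int.cast_abs]
    exact_mod_cast Int.one_le_abs hdet
  have hlt : (polyHeight P' : ℝ) < polyHeight Q' := by exact_mod_cast hPQ'.height_lt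
  have h2 : |(P'.coeff i : ℝ) * aeval ξ Q'| ≤ polyHeight Q' * |aeval ξ P'| := by
    rw [abs_mul]
    exact mul_le_mul ((abs_coeff_le_polyHeight P' i).trans hlt.le) hPQ'.aeval_lt.le
      (abs_nonneg _) (Nat.cast_nonneg _)
  have h3 : |(Q'.coeff i : ℝ) * aeval ξ P'| ≤ polyHeight Q' * |aeval ξ P'| := by
    rw [abs_mul]
    exact mul_le_mul_of_nonneg_right (abs_coeff_le_polyHeight Q' i) (abs_nonneg _)
  have h4 := abs_sub ((P'.coeff i : ℝ) * aeval ξ Q') (Q'.coeff i * aeval ξ P')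
  linarith

theorem IsConsecutive.not_dvd (hPQ : IsConsecutive n ξ P Q) (hQ : Q.natDegree = n) :
    ¬ Q ∣ P := by
  rintro ⟨T, hT⟩
  have hT0 : Q * T ≠ 0 := hT ▸ hPQ.left.ne_zero
  have hd := hPQ.left.natDegree_le
  rw [hT, natDegree_mul (left_ne_zero_of_mul hT0) (right_ne_zero_of_mul hT0)] at hd
  obtain ⟨t, rfl⟩ := natDegree_eq_zero.mp (show T.natDegree = 0 by omega)
  have ht : t ≠ 0 := by simpa using right_ne_zero_of_mul hT0
  have h1 := polyHeight_C_mul t Q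
  rw [mul_comm, ← hT] at h1
  have h2 : (1 : ℝ) ≤ |(t : ℝ)| := by
    rw [← Int.cast_abs]; exact_mod_cast Int.one_le_abs ht
  have h3 : (polyHeight P : ℝ) < polyHeight Q := by exact_mod_cast hPQ.height_lt
  have h4 : (0 : ℝ) ≤ polyHeight Q := Nat.cast_nonneg _
  nlinarith

end Plane

section Growth

/-- The growth conditions satisfied by the logarithmic heights of minimal points are
incompatible. -/
theorem false_of_growth {m s : ℝ} (hm : 0 ≤ m) (hs : m < s)
    (hq : (m + 1) ^ 2 < s ^ 2 + (m + 1) * s) (x : ℕ → ℝ) (N : ℕ) (hmono : Monotone x)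
    (hpos : ∀ k, N ≤ k → 0 < x k) (hupper : ∀ k, N ≤ k → s * x (k + 1) ≤ (m + 1) * x k)
    (hlower : ∀ k, N ≤ k → ∃ j, k < j ∧
      (s + m + 1) * x j ≤ m * (x k + x (k + 1)) + x (j + 1)) : False := by
  have hs0 : 0 < s := by linarith
  set ρ := (m + 1) / s with hρ
  have hρ0 : 0 < ρ := by positivity
  have hρs : ρ * s = m + 1 := div_mul_cancel₀ _ hs0.ne'
  have hqρ : 0 < -ρ ^ 2 + (s + 1) * ρ - m := by
    have : (-ρ ^ 2 + (s + 1) * ρ - m) * s ^ 2 = s ^ 2 + (m + 1) * s - (m + 1) ^ 2 := by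
      linear_combination (-(ρ * s) - (m + 1) + (s + 1) * s) * hρs
    by_contra! h
    nlinarith [mul_nonpos_of_nonpos_of_nonneg h (sq_nonneg s)]
  set δ := min (s - m) (-ρ ^ 2 + (s + 1) * ρ - m) / ρ with hδ
  have hδ0 : 0 < δ := div_pos (lt_min (by linarith) hqρ) hρ0
  have hratio : ∀ k, N ≤ k → 1 ≤ x (k + 1) / x k ∧ x (k + 1) / x k ≤ ρ := by
    intro k hk
    have h0 := hpos k hk
    rw [le_div_iff₀ h0, div_le_iff₀ h0, one_mul]
    refine ⟨hmono (Nat.le_succ k), ?_⟩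
    rw [hρ, div_mul_eq_mul_div, le_div_iff₀ hs0, mul_comm]
    exact hupper k hk
  have hstep : ∀ k, N ≤ k → ∃ j, k < j ∧ x (k + 1) / x k + δ ≤ x (j + 1) / x j := by
    intro k hk
    obtain ⟨j, hkj, hj⟩ := hlower k hk
    refine ⟨j, hkj, ?_⟩
    have hk0 := hpos k hk
    have hj0 := hpos j (by omega)
    obtain ⟨ht1, htρ⟩ := hratio k hk
    set t := x (k + 1) / x k with ht
    have ht0 : 0 < t := by linarith
    have hxk : x (k + 1) = t * x k := (div_mul_cancel₀ _ hk0.ne').symm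
    have hkj' : x (k + 1) ≤ x j := hmono hkj
    have h1 : s + 1 - m / t ≤ x (j + 1) / x j := by
      rw [le_div_iff₀ hj0]
      have hxk' : x k ≤ x j / t := by
        rw [le_div_iff₀ ht0, mul_comm, ← hxk]; exact hkj'
      have h2 : m * (x k + x (k + 1)) ≤ m * (x j / t + x j) := by gcongr
      have h3 : (s + 1 - m / t) * x j = (s + m + 1) * x j - m * (x j / t + x j) := by
        field_simp; ring
      linarith
    have h2 : δ ≤ (-t ^ 2 + (s + 1) * t - m) / t := by
      have hle : min (s - m) (-ρ ^ 2 + (s + 1) * ρ - m) ≤ -t ^ 2 + (s + 1) * t - m := by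
        rcases le_total (s - t) 0 with h | h
        · refine (min_le_right _ _).trans ?_
          nlinarith [mul_nonneg (sub_nonneg.mpr htρ) (sub_nonneg.mpr ht1)]
        · refine (min_le_left _ _).trans ?_
          nlinarith [mul_nonneg (sub_nonneg.mpr ht1) h]
      rw [hδ]
      have hmin0 : 0 < min (s - m) (-ρ ^ 2 + (s + 1) * ρ - m) := lt_min (by linarith) hqρ
      exact div_le_div₀ (hmin0.le.trans hle) hle ht0 htρ
    have h3 : (-t ^ 2 + (s + 1) * t - m) / t = s + 1 - m / t - t := by
      field_simp; ring
    linarith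
  have hgrow : ∀ i : ℕ, ∃ k, N ≤ k ∧ 1 + i * δ ≤ x (k + 1) / x k := by
    intro i
    induction i with
    | zero => exact ⟨N, le_rfl, by simpa using (hratio N le_rfl).1⟩
    | succ i ih =>
      obtain ⟨k, hk, h⟩ := ih
      obtain ⟨j, hkj, hj⟩ := hstep k hk
      refine ⟨j, by omega, ?_⟩
      push_cast
      linarith
  obtain ⟨i, hi⟩ := exists_nat_gt (ρ / δ)
  obtain ⟨k, hk, h⟩ := hgrow i
  have := (hratio k hk).2
  rw [div_lt_iff₀ hδ0] at hi
  linarith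

end Growth

section MinimalSequence

variable {n m : ℕ} {ξ w v : ℝ}

theorem exists_seq_isConsecutive (hw : w ∈ uniformExpSet n ξ) (hw0 : 0 < w)
    (hwn : (n : ℝ) - 1 < w) : ∃ P : ℕ → ℤ[X], ∀ k, IsConsecutive n ξ (P k) (P (k + 1)) := by
  have hsmall : ∀ ε > 0, ∃ R : ℤ[X], R ≠ 0 ∧ R.natDegree ≤ n ∧ |aeval ξ R| < ε := by
    intro ε hε
    obtain ⟨x, hx, R, hRn, -, hR0, hRw⟩ := ((eventually_mul_rpow_neg_lt 1 hw0 hε).and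
      (show ∀ᶠ X : ℝ in atTop, _ from hw)).exists
    refine ⟨R, ?_, hRn, by linarith⟩
    rintro rfl
    simp at hR0
  have hnext : ∀ P : {P : ℤ[X] // IsMinimalPoint n ξ P},
      ∃ Q : {P : ℤ[X] // IsMinimalPoint n ξ P}, IsConsecutive n ξ P Q := by
    rintro ⟨P, hP⟩
    obtain ⟨Q, hQ⟩ := exists_isConsecutive hsmall
      (fun R h0 hd => aeval_ne_zero_of_mem_uniformExpSet hw hwn h0 hd) hP
    exact ⟨⟨Q, hQ.right⟩, hQ⟩
  choose f hf using hnext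
  obtain ⟨P₀, hP₀⟩ := exists_isMinimalPoint n ξ
  exact ⟨fun k => (Nat.rec ⟨P₀, hP₀⟩ (fun _ P => f P) k : {P : ℤ[X] // IsMinimalPoint n ξ P}),
    fun k => hf _⟩

theorem tendsto_log_polyHeight {P : ℕ → ℤ[X]} (hP : ∀ k, IsConsecutive n ξ (P k) (P (k + 1))) :
    Tendsto (fun k => Real.log (polyHeight (P k))) atTop atTop :=
  Real.tendsto_log_atTop.comp (tendsto_natCast_atTop_atTop.comp
    (strictMono_nat_of_lt_succ fun k => (hP k).height_lt).tendsto_atTop)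

theorem eventually_log_abs_aeval_le (hw : w ∈ uniformExpSet n ξ) {P : ℕ → ℤ[X]}
    (hne : ∀ k, aeval ξ (P k) ≠ 0) (hP : ∀ k, IsConsecutive n ξ (P k) (P (k + 1))) :
    ∀ᶠ k in atTop, Real.log |aeval ξ (P k)| ≤
      w * Real.log 2 - w * Real.log (polyHeight (P (k + 1))) := by
  have hlim : Tendsto (fun k => (polyHeight (P (k + 1)) : ℝ) / 2) atTop atTop :=
    ((tendsto_natCast_atTop_atTop.comp
      (strictMono_nat_of_lt_succ fun k => (hP k).height_lt).tendsto_atTop).comp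
      (tendsto_add_atTop_nat 1)).atTop_div_const two_pos
  filter_upwards [hlim.eventually hw] with k ⟨R, hRn, hRh, hR0, hRw⟩
  have hH : (1 : ℝ) ≤ polyHeight (P (k + 1)) := one_le_polyHeight (hP k).right.ne_zero
  have hR : R ≠ 0 := by rintro rfl; simp at hR0
  have hlt : (polyHeight R : ℝ) < polyHeight (P (k + 1)) := by linarith
  have h1 := (hP k).le_of_height_lt R hR hRn (by exact_mod_cast hlt)
  have h2 := Real.log_le_log (abs_pos.mpr (hne k)) (h1.trans hRw.le)
  rw [Real.log_rpow (by positivity), Real.log_div (by positivity) two_ne_zero] at h2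
  linarith

theorem log_combination_nonneg {K : ℝ} (hK : 0 < K) {L p q r : ℝ} {a b c : ℕ} (hL : 0 < L)
    (hp : 0 < p) (hq : 0 < q) (hr : 0 < r)
    (h : 1 ≤ K * (L / p * (p ^ a * q ^ b * r ^ c))) :
    0 ≤ Real.log K + Real.log L - Real.log p + a * Real.log p + b * Real.log q +
      c * Real.log r := by
  have h1 := Real.log_nonneg h
  rw [Real.log_mul (by positivity) (by positivity), Real.log_mul (by positivity) (by positivity),
    Real.log_div hL.ne' hp.ne', Real.log_mul (by positivity) (by positivity),
    Real.log_mul (by positivity) (by positivity), Real.log_pow, Real.log_pow, Real.log_pow] at h1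
  linarith

/-- The uniform exponent cannot exceed a bound `v` satisfying the two growth conditions. -/
theorem not_mem_uniformExpSet_of_lt (hvw : v < w) (hv : 2 * (m : ℝ) + 2 < v)
    (hq : ((m : ℝ) + 1) ^ 2 < (v - (m + 2)) ^ 2 + (m + 1) * (v - (m + 2))) :
    w ∉ uniformExpSet (m + 2) ξ := by
  intro hw
  have hm0 : (0 : ℝ) ≤ m := Nat.cast_nonneg m
  have hw0 : 0 < w := by linarith
  have hwn : ((m + 2 : ℕ) : ℝ) - 1 < w := by push_cast; linarith
  obtain ⟨P, hP⟩ := exists_seq_isConsecutive hw hw0 hwn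
  have hne : ∀ k, aeval ξ (P k) ≠ 0 := fun k =>
    aeval_ne_zero_of_mem_uniformExpSet hw hwn (hP k).left.ne_zero (hP k).left.natDegree_le
  have hL0 : ∀ k, 0 < |aeval ξ (P k)| := fun k => abs_pos.mpr (hne k)
  have hH0 : ∀ k, (0 : ℝ) < polyHeight (P k) := fun k =>
    zero_lt_one.trans_le (one_le_polyHeight (hP k).left.ne_zero)
  set x : ℕ → ℝ := fun k => Real.log (polyHeight (P k)) with hx
  set l : ℕ → ℝ := fun k => Real.log |aeval ξ (P k)| with hl
  have hxlim : Tendsto x atTop atTop := tendsto_log_polyHeight hP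
  have hHmono : Monotone fun k => polyHeight (P k) :=
    monotone_nat_of_le_succ fun k => (hP k).height_lt.le
  have hLanti : Antitone fun k => |aeval ξ (P k)| :=
    antitone_nat_of_succ_le fun k => (hP k).aeval_lt.le
  have hxmono : Monotone x := fun i j hij =>
    Real.log_le_log (hH0 i) (by exact_mod_cast hHmono hij)
  have hupper := eventually_log_abs_aeval_le hw hne hP
  obtain ⟨c, hc, hprime⟩ := exists_prime_of_isMinimalPoint (by omega) hw
    (by push_cast; linarith)
  set K₁ : ℝ := (2 * (m + 2)).factorial * max 1 |ξ| ^ (m + 2) with hK₁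
  set K₂ : ℝ := (2 * m + 3).factorial * max 1 |ξ| ^ m with hK₂
  have hK₁0 : 0 < K₁ := by positivity
  have hK₂0 : 0 < K₂ := by positivity
  set B := w * Real.log 2 + |Real.log K₁| + |Real.log K₂| + Real.log 4 with hB
  have hB1 : Real.log K₁ + w * Real.log 2 ≤ B := by
    have := le_abs_self (Real.log K₁)
    have := abs_nonneg (Real.log K₂)
    have := Real.log_nonneg (show (1 : ℝ) ≤ 4 by norm_num)
    linarith
  have hB2 : Real.log K₂ + Real.log 4 + w * Real.log 2 ≤ B := by
    have := le_abs_self (Real.log K₂)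
    have := abs_nonneg (Real.log K₁)
    linarith
  obtain ⟨N, hN⟩ := eventually_atTop.mp (hupper.and ((hxlim.eventually_gt_atTop 0).and
    ((hxlim.eventually_ge_atTop (B / (w - v))).and (hxlim.eventually_gt_atTop
      ((w * Real.log 2 - Real.log c) / (w - (2 * m + 2)))))))
  have hlx : ∀ k, N ≤ k → l k ≤ w * Real.log 2 - w * x (k + 1) := fun k hk => (hN k hk).1
  have hpos : ∀ k, N ≤ k → 0 < x k := fun k hk => (hN k hk).2.1
  have hBx : ∀ k, N ≤ k → B ≤ (w - v) * x k := fun k hk => by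
    have := (hN k hk).2.2.1
    rwa [div_le_iff₀ (by linarith), mul_comm] at this
  have hprime' : ∀ k, N ≤ k → Prime (P k) ∧ (P k).natDegree = m + 2 := by
    intro k hk
    refine hprime _ (hP k).left ?_
    rw [← Real.log_lt_log_iff (mul_pos (hL0 k) (pow_pos (hH0 k) _)) hc,
      Real.log_mul (hL0 k).ne' (pow_pos (hH0 k) _).ne', Real.log_pow]
    have h1 := (hN k hk).2.2.2
    rw [div_lt_iff₀ (by linarith)] at h1
    have h2 := hlx k hk
    have h3 : w * x k ≤ w * x (k + 1) := mul_le_mul_of_nonneg_left (hxmono k.le_succ) hw0.le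
    have h4 : ((2 * (m + 2) - 2 : ℕ) : ℝ) = 2 * m + 2 := by
      rw [show 2 * (m + 2) - 2 = 2 * m + 2 by omega]; push_cast; ring
    rw [h4]
    change l k + (2 * m + 2) * x k < Real.log c
    nlinarith
  have hnd : ∀ k, N ≤ k → ¬ P (k + 1) ∣ P k := fun k hk =>
    (hP k).not_dvd (hprime' (k + 1) (by omega)).2
  have hratio : ∀ i k, k ≤ i →
      |aeval ξ (P i)| ≤ |aeval ξ (P k)| / polyHeight (P k) * polyHeight (P i) := by
    intro i k hki
    rw [div_mul_eq_mul_div, le_div_iff₀ (hH0 k)]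
    exact mul_le_mul (hLanti hki) (by exact_mod_cast hHmono hki) (hH0 k).le (hL0 k).le
  refine false_of_growth hm0 (s := v - (m + 2)) (by linarith) hq x N hxmono hpos ?_ ?_
  · intro k hk
    obtain ⟨hQ, hQd⟩ := hprime' (k + 1) (by omega)
    have h1 := one_le_of_prime_of_not_dvd (ξ := ξ) hQ (hnd k hk) (hP k).left.natDegree_le
      (by omega) hQd.le le_rfl le_rfl (hratio k k le_rfl) (hratio (k + 1) k k.le_succ)
    rw [hQd] at h1
    have h2 := log_combination_nonneg hK₁0 (hL0 k) (hH0 k) (hH0 (k + 1)) one_pos (c := 0)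
      (by simpa using h1)
    have h3 := hlx k hk
    have h4 := hBx (k + 1) (by omega)
    push_cast at h2
    change 0 ≤ Real.log K₁ + l k - x k + (m + 2) * x k + (m + 2) * x (k + 1) + _ at h2
    linarith
  · intro k hk
    have hplane : ∀ i, k ≤ i → (∃ a b : ℤ, P i = C a * P k + C b * P (k + 1)) →
        (∃ a b : ℤ, P (i + 1) = C a * P k + C b * P (k + 1)) →
        l k + x (k + 1) ≤ Real.log 4 + w * Real.log 2 - (w - 1) * x (i + 1) := by
      rintro i hi ⟨a, b, hab⟩ ⟨a', b', hab'⟩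
      obtain ⟨hQ, hQd⟩ := hprime' (i + 1) (by omega)
      have h1 := Real.log_le_log (mul_pos (hL0 k) (hH0 (k + 1)))
        ((hP k).mul_height_le (hP i) hQ (by omega) (hnd i (by omega)) hab hab')
      rw [Real.log_mul (hL0 k).ne' (hH0 _).ne', Real.log_mul four_ne_zero
        (mul_pos (hL0 i) (hH0 _)).ne', Real.log_mul (hL0 i).ne' (hH0 _).ne'] at h1
      change l k + x (k + 1) ≤ Real.log 4 + (l i + x (i + 1)) at h1
      have h2 := hlx i (by omega)
      linarith
    have hex : ∃ i, ¬ ∃ a b : ℤ, P (k + i) = C a * P k + C b * P (k + 1) := by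
      by_contra! hall
      obtain ⟨i, hi⟩ := (((tendsto_add_atTop_iff_nat (k + 1)).mpr hxlim).eventually_gt_atTop
        ((Real.log 4 + w * Real.log 2 - l k - x (k + 1)) / (w - 1))).exists
      have h1 := hplane (k + i) (by omega) (hall i) (hall (i + 1))
      rw [div_lt_iff₀ (by linarith), show i + (k + 1) = k + i + 1 by omega] at hi
      linarith
    classical
    obtain ⟨i, hi, hmin⟩ : ∃ i, (¬ ∃ a b : ℤ, P (k + i) = C a * P k + C b * P (k + 1)) ∧
        ∀ j < i, ∃ a b : ℤ, P (k + j) = C a * P k + C b * P (k + 1) :=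
      ⟨Nat.find hex, Nat.find_spec hex, fun j hj => not_not.mp (Nat.find_min hex hj)⟩
    obtain ⟨j, rfl⟩ : ∃ j, i = j + 2 := by
      refine ⟨i - 2, ?_⟩
      have h0 : i ≠ 0 := by
        rintro rfl
        exact hi ⟨1, 0, by simp⟩
      have h1 : i ≠ 1 := by
        rintro rfl
        exact hi ⟨0, 1, by simp⟩
      omega
    refine ⟨k + j + 1, by omega, ?_⟩
    have h1 := hplane (k + j) (by omega) (hmin j (by omega)) (hmin (j + 1) (by omega))
    obtain ⟨hQ, hQd⟩ := hprime' (k + 1) (by omega)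
    have h2 := one_le_of_prime_of_independent (ξ := ξ) (R := P (k + (j + 2))) hQ (hnd k hk) hQd
      (hP k).left.natDegree_le (hP _).left.natDegree_le
      (fun c a b h => by
        by_contra hc0
        exact hi ((hP k).exists_eq_add_of_smul_eq (hP _).left.natDegree_le hc0 h))
      le_rfl le_rfl le_rfl (hratio k k le_rfl) (hratio (k + 1) k k.le_succ)
      (hratio _ k (by omega))
    have h3 := log_combination_nonneg hK₂0 (hL0 k) (hH0 k) (hH0 (k + 1)) (hH0 (k + (j + 2)))
      (c := 1) (by simpa using h2)
    have h4 := hBx (k + j + 1) (by omega)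
    push_cast at h3
    change 0 ≤ Real.log K₂ + l k - x k + (m + 1) * x k + (m + 1) * x (k + 1) +
      1 * x (k + j + 1 + 1) at h3
    linarith

end MinimalSequence

/-- The root `β` satisfies the quadratic growth condition. -/
theorem sq_le_of_root (m : ℕ) {β : ℝ} (hβ : 2 * (m : ℝ) + 2 < β)
    (hroot : β ^ 4 + (4 - 4 * ((m : ℝ) + 2)) * β ^ 3 +
      (5 * ((m : ℝ) + 2) ^ 2 - 12 * ((m : ℝ) + 2) + 8) * β ^ 2 +
      (-2 * ((m : ℝ) + 2) ^ 3 + 11 * ((m : ℝ) + 2) ^ 2 - 18 * ((m : ℝ) + 2) + 7) * β +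
      (-2 * ((m : ℝ) + 2) ^ 3 + 6 * ((m : ℝ) + 2) ^ 2 - 4 * ((m : ℝ) + 2)) = 0) :
    ((m : ℝ) + 1) ^ 2 ≤ (β - (m + 2)) ^ 2 + (m + 1) * (β - (m + 2)) := by
  rcases m with _ | _ | m
  · norm_num at *
    have h1 : β * (β - 1) * (β ^ 2 - 3 * β + 1) = 0 := by linear_combination hroot
    have h2 : β ^ 2 - 3 * β + 1 = 0 :=
      (mul_eq_zero.mp h1).resolve_left (mul_pos (by linarith) (by linarith)).ne'
    nlinarith
  · norm_num at *
    have h1 : (β - 3) * (β ^ 3 - 5 * β ^ 2 + 2 * β + 4) = 0 := by linear_combination hroot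
    have h2 : β ^ 3 - 5 * β ^ 2 + 2 * β + 4 = 0 :=
      (mul_eq_zero.mp h1).resolve_left (by linarith)
    by_contra! h
    nlinarith [mul_pos (sub_pos.mpr h) (show 0 < β - 1 by linarith)]
  · push_cast at *
    have hm : (0 : ℝ) ≤ m := Nat.cast_nonneg m
    nlinarith

/-- For `n ≥ 2` and `β_n` the root of `Q_n` in `(2n-2, 2n-1)`,
every real `ξ` satisfies `ŵ_n(ξ) ≤ β_n`. -/
theorem stmt0 (n : ℕ) (hn : 2 ≤ n) (β : ℝ)
    (hβ : β ∈ Set.Ioo (2*(n:ℝ)-2) (2*(n:ℝ)-1))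
    (hroot : β^4 + (4-4*(n:ℝ))*β^3 + (5*(n:ℝ)^2-12*(n:ℝ)+8)*β^2
      + (-2*(n:ℝ)^3+11*(n:ℝ)^2-18*(n:ℝ)+7)*β + (-2*(n:ℝ)^3+6*(n:ℝ)^2-4*(n:ℝ)) = 0)
    (ξ : ℝ) :
    wHat n ξ ≤ (β : EReal) := by
  obtain ⟨m, rfl⟩ : ∃ m, n = m + 2 := ⟨n - 2, by omega⟩
  push_cast at hβ hroot
  have hm : (0 : ℝ) ≤ m := Nat.cast_nonneg m
  have hβ1 : 2 * (m : ℝ) + 2 < β := by linarith [hβ.1]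
  have hsq := sq_le_of_root m hβ1 hroot
  refine sSup_le ?_
  rintro _ ⟨w, hw, rfl⟩
  rw [EReal.coe_le_coe_iff]
  by_contra! hlt
  refine not_mem_uniformExpSet_of_lt (v := (β + w) / 2) (by linarith) (by linarith) ?_ hw
  have h1 : β < (β + w) / 2 := by linarith
  nlinarith
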